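/- Let f ∈ AP(ℍ). Then f is bounded on ℍ + ic for some c > 0 if and only if spec(f) ⊂ [0,∞). In this case f is bounded on ℍ + ic for every c > 0 and lim_{y→∞} sup_{x∈ℝ} |f(x+iy) − ℰf(0)| = 0. -/

import Mathlib

open MeasureTheory Complex Filter Topology Set
open scoped ENNReal

noncomputable section

/-- The open upper half-plane, as a subset of `ℂ`. -/
def UHP : Set ℂ := {z : ℂ | 0 < z.im}

/-- A relatively dense subset of `ℝ`. -/
def RelDense (τ : Set ℝ) : Prop := ∃ l > (0:ℝ), ∀ x : ℝ, ∃ t ∈ τ, x < t ∧ t < x + l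

/-- Bohr almost periodic continuous functions on `ℝ`. -/
def APR (f : ℝ → ℂ) : Prop :=
  Continuous f ∧ ∀ ε > (0:ℝ), RelDense {t : ℝ | ∀ x : ℝ, ‖f x - f (x + t)‖ ≤ ε}

/-- Holomorphic almost periodic functions on the upper half-plane. -/
def APH (f : ℂ → ℂ) : Prop :=
  DifferentiableOn ℂ f UHP ∧
  ∀ α β ε : ℝ, 0 < α → α < β → 0 < ε →
    ∃ τ : Set ℝ, RelDense τ ∧
      ∀ t ∈ τ, ∀ z : ℂ, α < z.im → z.im < β → ‖f z - f (z + (t : ℂ))‖ ≤ ε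

/-- `HasMeanAt f y lam c` : the mean `(1/2T)∫_{-T+iy}^{T+iy} f(z) e^{-2πiλz} dz` tends to `c`. -/
def HasMeanAt (f : ℂ → ℂ) (y lam : ℝ) (c : ℂ) : Prop :=
  Tendsto (fun T : ℝ => (1 / (2 * (T : ℂ))) *
      ∫ x in (-T)..T, f ((x : ℂ) + (y : ℂ) * Complex.I) *
        Complex.exp (-(2 * (Real.pi : ℂ) * Complex.I * (lam : ℂ) * ((x : ℂ) + (y : ℂ) * Complex.I))))
    atTop (𝓝 c)

/-- `HasMeanR f lam c` : the Bohr mean `(1/2T)∫_{-T}^{T} f(x) e^{-2πiλx} dx` tends to `c`. -/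
def HasMeanR (f : ℝ → ℂ) (lam : ℝ) (c : ℂ) : Prop :=
  Tendsto (fun T : ℝ => (1 / (2 * (T : ℂ))) *
      ∫ x in (-T)..T, f x *
        Complex.exp (-(2 * (Real.pi : ℂ) * Complex.I * (lam : ℂ) * (x : ℂ))))
    atTop (𝓝 c)

/-- The spectrum of a function on the upper half-plane: frequencies where the mean is not `0`. -/
def specH (f : ℂ → ℂ) : Set ℝ := {lam : ℝ | ∃ y > (0:ℝ), ¬ HasMeanAt f y lam 0}

/-- A locally finite subset of `ℝ`. -/
def LocFinSet (S : Set ℝ) : Prop := ∀ a b : ℝ, (S ∩ Set.Ioo a b).Finite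

/-- A uniformly discrete subset of `ℝ`. -/
def UnifDiscrete (S : Set ℝ) : Prop :=
  ∃ d > (0:ℝ), ∀ x ∈ S, ∀ y ∈ S, x ≠ y → d ≤ |x - y|

/-- Locally summable coefficient functions. -/
def LocSummable (a : ℝ → ℂ) : Prop :=
  (Function.support a).Countable ∧
  ∀ T > (0:ℝ), Summable (Set.indicator (Set.Icc (-T) T) fun l => ‖a l‖)

/-- Exponential growth of a coefficient function. -/
def ExpGrowth (a : ℝ → ℂ) : Prop :=
  ∃ c > (0:ℝ), Summable fun lam : ℝ => ‖a lam‖ * Real.exp (-c * |lam|)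

/-- `a(-λ) = conj (a(λ))`. -/
def Antipodal (a : ℝ → ℂ) : Prop := ∀ lam : ℝ, a (-lam) = (starRingEnd ℂ) (a lam)

/-- The Fourier transform `φ̂(ξ) = ∫ φ(x) e^{-2πixξ} dx`. -/
def FT (φ : ℝ → ℂ) (ξ : ℝ) : ℂ :=
  ∫ x : ℝ, φ x * Complex.exp (-(2 * (Real.pi : ℂ) * Complex.I * (x : ℂ) * (ξ : ℂ)))

/-- A complex-valued measure on `ℝ`, encoded by its total variation `ν` together with a
unimodular density `w`, so that `dμ = w dν` and `|μ| = ν`. -/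
structure CMeasure where
  ν : Measure ℝ
  w : ℝ → ℂ
  meas : Measurable w
  unit : ∀ᵐ t ∂ν, ‖w t‖ = 1

/-- Integration against a complex measure. -/
def CMeasure.integral (μ : CMeasure) (φ : ℝ → ℂ) : ℂ := ∫ t, φ t * μ.w t ∂μ.ν

/-- Strongly tempered: every Schwartz function is `|μ|`-integrable. -/
def CMeasure.IsStronglyTempered (μ : CMeasure) : Prop :=
  ∀ φ : SchwartzMap ℝ ℂ, Integrable (fun t => φ t) μ.ν

/-- Real-valued complex measure. -/
def CMeasure.RealValued (μ : CMeasure) : Prop := ∀ᵐ t ∂μ.ν, (μ.w t).im = 0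

/-- Nonnegative complex measure. -/
def CMeasure.Nonneg (μ : CMeasure) : Prop := ∀ᵐ t ∂μ.ν, μ.w t = 1

/-- `deg(μ) ≤ n` : `∫ (1+t²)^{-n/2} d|μ| < ∞`. -/
def CMeasure.DegLE (μ : CMeasure) (n : ℕ) : Prop :=
  Integrable (fun t : ℝ => (1 + t ^ 2) ^ (-(n : ℝ) / 2)) μ.ν

/-- The mass `μ({x})` of an atom. -/
def CMeasure.atom (μ : CMeasure) (x : ℝ) : ℂ := ∫ t in {x}, μ.w t ∂μ.ν

/-- The (closed) support of a measure on `ℝ`. -/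
def measSupport (ν : Measure ℝ) : Set ℝ := {x : ℝ | ∀ U ∈ 𝓝 x, ν U ≠ 0}

/-- `(μ, a)` is a Fourier summation pair. -/
def IsFSPair (μ : CMeasure) (a : ℝ → ℂ) : Prop :=
  μ.IsStronglyTempered ∧ LocSummable a ∧
    ∀ φ : ℝ → ℂ, ContDiff ℝ (⊤ : ℕ∞) φ → HasCompactSupport φ →
      μ.integral (FT φ) = ∑' lam : ℝ, a lam * φ lam

/-- Trigonometric polynomials. -/
def IsTrigPoly (f : ℂ → ℂ) : Prop :=
  ∃ (N : ℕ) (p : Fin N → ℂ) (θ : Fin N → ℝ),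
    ∀ z : ℂ, f z = ∑ n, p n * Complex.exp (2 * (Real.pi : ℂ) * Complex.I * (θ n : ℂ) * z)

/-- Functions of bounded type on the upper half-plane. -/
def BoundedType (g : ℂ → ℂ) : Prop :=
  ∃ P Q : ℂ → ℂ, DifferentiableOn ℂ P UHP ∧ DifferentiableOn ℂ Q UHP ∧
    (∃ C : ℝ, ∀ z ∈ UHP, ‖P z‖ ≤ C) ∧ (∃ C : ℝ, ∀ z ∈ UHP, ‖Q z‖ ≤ C) ∧
    (∀ z ∈ UHP, Q z ≠ 0) ∧ ∀ z ∈ UHP, g z = P z / Q z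

/-- Mean type `ϑ(g) = limsup_{y→∞} log|g(iy)|/y`. -/
def MeanType (g : ℂ → ℂ) : ℝ :=
  Filter.limsup (fun y : ℝ => Real.log ‖g ((y : ℂ) * Complex.I)‖ / y) atTop

/-- `E*(z) = conj (E (conj z))`. -/
def fstar (E : ℂ → ℂ) : ℂ → ℂ := fun z => (starRingEnd ℂ) (E ((starRingEnd ℂ) z))

/-- Hermite–Biehler class: entire with `|E*(z)| < |E(z)|` on the upper half-plane. -/
def HB (E : ℂ → ℂ) : Prop := Differentiable ℂ E ∧ ∀ z ∈ UHP, ‖fstar E z‖ < ‖E z‖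

/-- `A = (E* + E)/2`. -/
def HBA (E : ℂ → ℂ) : ℂ → ℂ := fun z => (fstar E z + E z) / 2

/-- `B = (E* - E)/(2i)`. -/
def HBB (E : ℂ → ℂ) : ℂ → ℂ := fun z => (fstar E z - E z) / (2 * Complex.I)

/-- `φ` is a phase function for `E`, with derivative `φd > 0`. -/
def IsPhaseFor (φ φd : ℝ → ℝ) (E : ℂ → ℂ) : Prop :=
  (∀ x : ℝ, HasDerivAt φ (φd x) x) ∧ (∀ x : ℝ, 0 < φd x) ∧
    ∀ x : ℝ, (Complex.exp (Complex.I * (φ x : ℂ)) * E (x : ℂ)).im = 0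

/-- The points where `φ ≡ 0 (mod π)`. -/
def phaseZeros (φ : ℝ → ℝ) : Set ℝ := {γ : ℝ | ∃ k : ℤ, φ γ = k * Real.pi}

/-- The nonnegative measure `2π Σ_{φ(γ)≡0 (mod π)} (1/φ'(γ)) δ_γ`. -/
def phaseMeasure (φ φd : ℝ → ℝ) : Measure ℝ :=
  Measure.sum fun γ : phaseZeros φ =>
    (ENNReal.ofReal (2 * Real.pi / φd (γ : ℝ))) • Measure.dirac (γ : ℝ)

/-- `μ` is an `ℕ`-valued nonnegative measure. -/
def CMeasure.NValued (μ : CMeasure) : Prop :=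
  μ.Nonneg ∧ ∃ (Λ : Set ℝ) (m : ℝ → ℕ), LocFinSet Λ ∧ (∀ γ ∈ Λ, 0 < m γ) ∧
    μ.ν = Measure.sum fun γ : Λ => (m (γ : ℝ) : ℝ≥0∞) • Measure.dirac (γ : ℝ)

/-- Bounded on every horizontal substrip of the upper half-plane. -/
def BddOnStrips (f : ℂ → ℂ) : Prop :=
  ∀ ε > (0:ℝ), ∃ C : ℝ, ∀ z : ℂ, ε < z.im → z.im < 1/ε → ‖f z‖ ≤ C

/-- The Fejér-type partial sums in formula (eq:fdef). -/
def fdefSum (a : ℝ → ℂ) (T : ℝ) (z : ℂ) : ℂ :=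
  a 0 / 2 + ∑' lam : ℝ,
    Set.indicator (Set.Ioo (0 : ℝ) T)
      (fun l => a l * (1 - (l : ℂ) / (T : ℂ)) *
        Complex.exp (2 * (Real.pi : ℂ) * Complex.I * (l : ℂ) * z)) lam

/-- The character `x ↦ e^{-2πiλx}` of the real line. -/
def expChar (lam x : ℝ) : ℂ := cexp (-(2 * (Real.pi : ℂ) * Complex.I * (lam : ℂ) * (x : ℂ)))

lemma norm_expChar (lam x : ℝ) : ‖expChar lam x‖ = 1 := by
  have : -(2 * (Real.pi : ℂ) * Complex.I * (lam : ℂ) * (x : ℂ))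
      = ((-(2 * Real.pi * lam * x) : ℝ) : ℂ) * Complex.I := by push_cast; ring
  rw [expChar, this, Complex.norm_exp_ofReal_mul_I]

lemma expChar_add (lam x y : ℝ) : expChar lam (x + y) = expChar lam x * expChar lam y := by
  simp only [expChar, ← Complex.exp_add]
  congr 1
  push_cast
  ring

@[fun_prop]
lemma continuous_expChar (lam : ℝ) : Continuous (expChar lam) := by
  unfold expChar
  fun_prop

lemma norm_expChar_sub_le (lam μ x : ℝ) :
    ‖expChar lam x - expChar μ x‖ ≤ 2 * Real.pi * |lam - μ| * |x| := by
  have h1 : expChar lam x = cexp (Complex.I * ((-(2 * Real.pi * (lam - μ) * x) : ℝ) : ℂ))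
      * expChar μ x := by
    simp only [expChar, ← Complex.exp_add]
    congr 1
    push_cast
    ring
  have h2 := Real.norm_exp_I_mul_ofReal_sub_one_le (x := -(2 * Real.pi * (lam - μ) * x))
  rw [h1, ← sub_one_mul, norm_mul, norm_expChar, mul_one]
  refine h2.trans (le_of_eq ?_)
  rw [norm_neg, norm_mul, norm_mul, norm_mul]
  simp [abs_of_pos Real.pi_pos]

lemma APR.exists_shift {f : ℝ → ℂ} (hf : APR f) {ε : ℝ} (hε : 0 < ε) :
    ∃ l > (0 : ℝ), ∀ u : ℝ, ∃ t : ℝ, u < t ∧ t < u + l ∧ ∀ x, ‖f x - f (x + t)‖ ≤ ε := by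
  obtain ⟨l, hl, h⟩ := hf.2 ε hε
  refine ⟨l, hl, fun u => ?_⟩
  obtain ⟨t, ht, h1, h2⟩ := h u
  exact ⟨t, h1, h2, ht⟩

lemma APR.bounded {f : ℝ → ℂ} (hf : APR f) : ∃ C > (0 : ℝ), ∀ x, ‖f x‖ ≤ C := by
  obtain ⟨l, hl, h⟩ := hf.exists_shift one_pos
  obtain ⟨C, hC⟩ := (isCompact_Icc (a := (0 : ℝ)) (b := l)).exists_bound_of_continuousOn
    hf.1.continuousOn
  refine ⟨max C 0 + 1, by positivity, fun x => ?_⟩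
  obtain ⟨t, h1, h2, ht⟩ := h (-x)
  have h3 := hC (x + t) ⟨by linarith, by linarith⟩
  have h4 := ht x
  have h5 := norm_le_norm_add_norm_sub' (f x) (f (x + t))
  linarith [le_max_left C 0]

lemma APR.exists_small_shift {f : ℝ → ℂ} (hf : APR f) {ε : ℝ} (hε : 0 < ε) :
    ∃ w > (0 : ℝ), ∀ s : ℝ, |s| ≤ w → ∀ x, ‖f x - f (x + s)‖ ≤ ε := by
  obtain ⟨l, hl, h⟩ := hf.exists_shift (ε := ε / 3) (by positivity)
  have huc := (isCompact_Icc (a := (-1 : ℝ)) (b := l + 1)).uniformContinuousOn_of_continuous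
    hf.1.continuousOn
  obtain ⟨δ, hδ, hd⟩ := Metric.uniformContinuousOn_iff.1 huc (ε / 3) (by positivity)
  refine ⟨min 1 (δ / 2), by positivity, fun s hs x => ?_⟩
  obtain ⟨t, h1, h2, ht⟩ := h (-x)
  have hs1 := abs_le.1 (hs.trans (min_le_left _ _))
  have hs2 := hs.trans (min_le_right _ _)
  have h3 := hd (x + t) ⟨by linarith, by linarith⟩ (x + s + t)
    ⟨by linarith [hs1.1], by linarith [hs1.2]⟩ (by
      rw [Real.dist_eq, show x + t - (x + s + t) = -s by ring, abs_neg]; linarith)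
  rw [dist_eq_norm] at h3
  have h4 := ht x
  have h5 := ht (x + s)
  rw [norm_sub_rev] at h5
  calc ‖f x - f (x + s)‖ = ‖(f x - f (x + t)) + (f (x + t) - f (x + s + t))
        + (f (x + s + t) - f (x + s))‖ := by congr 1; ring
    _ ≤ ‖f x - f (x + t)‖ + ‖f (x + t) - f (x + s + t)‖ + ‖f (x + s + t) - f (x + s)‖ :=
        norm_add₃_le
    _ ≤ ε := by linarith

lemma norm_integral_mul_expChar_le {f : ℝ → ℂ} {C : ℝ} (hC : ∀ x, ‖f x‖ ≤ C) (lam a b : ℝ) :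
    ‖∫ x in a..b, f x * expChar lam x‖ ≤ C * |b - a| :=
  intervalIntegral.norm_integral_le_of_norm_le_const fun x _ => by
    rw [norm_mul, norm_expChar, mul_one]; exact hC x

lemma integral_shift_mul_expChar (f : ℝ → ℂ) (lam a b t : ℝ) :
    ∫ x in (a + t)..(b + t), f x * expChar lam x
      = expChar lam t * ∫ x in a..b, f (x + t) * expChar lam x := by
  rw [← intervalIntegral.integral_const_mul,
    ← intervalIntegral.integral_comp_add_right (fun x => f x * expChar lam x)]
  congr 1 with x
  rw [expChar_add]
  ring

/-- Means of an almost periodic function over long intervals vanish uniformly in the position of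
the interval. -/
lemma APR.exists_uniform_mean {f : ℝ → ℂ} (hf : APR f) {lam : ℝ} (hm : HasMeanR f lam 0)
    {ε : ℝ} (hε : 0 < ε) :
    ∃ T > (0 : ℝ), ∀ a, ‖∫ x in a..(a + T), f x * expChar lam x‖ ≤ ε * T := by
  obtain ⟨C, hC0, hC⟩ := hf.bounded
  obtain ⟨l, hl, h⟩ := hf.exists_shift (ε := ε / 3) (by positivity)
  have hcont : Continuous fun x => f x * expChar lam x := hf.1.mul (continuous_expChar lam)
  have hcont' (t : ℝ) : Continuous fun x => f (x + t) * expChar lam x :=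
    (hf.1.comp (by fun_prop : Continuous fun x => x + t)).mul (continuous_expChar lam)
  have h1 : ∀ᶠ T : ℝ in atTop, ‖(1 / (2 * (T : ℂ))) * ∫ x in (-T)..T, f x * expChar lam x‖
      < ε / 3 := by
    have := hm.norm
    rw [norm_zero] at this
    exact this.eventually_lt_const (by positivity)
  obtain ⟨T, hT1, hT2, hT0⟩ := (h1.and ((eventually_ge_atTop (3 * l * C / ε)).and
    (eventually_gt_atTop 0))).exists
  refine ⟨2 * T, by positivity, fun a => ?_⟩
  have h2 : ‖∫ x in (-T)..T, f x * expChar lam x‖ ≤ ε / 3 * (2 * T) := by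
    rw [norm_mul, norm_div, norm_mul, Complex.norm_real, Real.norm_of_nonneg hT0.le] at hT1
    simp only [norm_one, Complex.norm_ofNat] at hT1
    rw [one_div, inv_mul_lt_iff₀ (by positivity)] at hT1
    linarith
  obtain ⟨t, ht1, ht2, ht⟩ := h (a + T - l)
  have h3 : ‖∫ x in (a - t)..(a - t + 2 * T), f x * expChar lam x‖
      ≤ ε / 3 * (2 * T) + 2 * (l * C) := by
    have hi : ∀ u v, IntervalIntegrable (fun x => f x * expChar lam x) volume u v :=
      fun u v => hcont.intervalIntegrable u v
    have e1 := intervalIntegral.integral_add_adjacent_intervals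
      (hi (a - t) (-T)) (hi (-T) T)
    have e2 := intervalIntegral.integral_add_adjacent_intervals
      (hi (a - t) T) (hi T (a - t + 2 * T))
    rw [← e2, ← e1]
    have n1 := norm_integral_mul_expChar_le hC lam (a - t) (-T)
    have n2 := norm_integral_mul_expChar_le hC lam T (a - t + 2 * T)
    have a1 : |-T - (a - t)| ≤ l := abs_le.2 ⟨by linarith, by linarith⟩
    have a2 : |a - t + 2 * T - T| ≤ l := abs_le.2 ⟨by linarith, by linarith⟩
    have b1 := mul_le_mul_of_nonneg_left a1 hC0.le
    have b2 := mul_le_mul_of_nonneg_left a2 hC0.le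
    refine norm_add₃_le.trans ?_
    linarith
  have h4 : ‖∫ x in a..(a + 2 * T), f x * expChar lam x‖
      = ‖∫ x in (a - t)..(a - t + 2 * T), f (x + t) * expChar lam x‖ := by
    have := integral_shift_mul_expChar f lam (a - t) (a - t + 2 * T) t
    rw [show a - t + t = a by ring, show a - t + 2 * T + t = a + 2 * T by ring] at this
    rw [this, norm_mul, norm_expChar, one_mul]
  have h5 : ‖(∫ x in (a - t)..(a - t + 2 * T), f x * expChar lam x)
      - ∫ x in (a - t)..(a - t + 2 * T), f (x + t) * expChar lam x‖ ≤ ε / 3 * (2 * T) := by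
    rw [← intervalIntegral.integral_sub (hcont.intervalIntegrable _ _)
      ((hcont' t).intervalIntegrable _ _)]
    have := intervalIntegral.norm_integral_le_of_norm_le_const (a := a - t) (b := a - t + 2 * T)
      (f := fun x => f x * expChar lam x - f (x + t) * expChar lam x) (C := ε / 3)
      fun x _ => by rw [← sub_mul, norm_mul, norm_expChar, mul_one]; exact ht x
    rwa [show a - t + 2 * T - (a - t) = 2 * T by ring, abs_of_pos (by positivity)] at this
  rw [h4]
  have h6 := norm_le_norm_add_norm_sub' (∫ x in (a - t)..(a - t + 2 * T), f (x + t) * expChar lam x)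
    (∫ x in (a - t)..(a - t + 2 * T), f x * expChar lam x)
  rw [norm_sub_rev] at h6
  have h7 : 3 * l * C ≤ T * ε := by rwa [div_le_iff₀ hε] at hT2
  linarith

lemma norm_integral_le_of_blocks {g : ℝ → ℂ} (hg : Continuous g) {C T₀ δ : ℝ} (hT₀ : 0 < T₀)
    (hC : ∀ x, ‖g x‖ ≤ C) (hδ : ∀ a, ‖∫ x in a..(a + T₀), g x‖ ≤ δ * T₀) {T : ℝ} (hT : 0 ≤ T) :
    ‖∫ x in (0 : ℝ)..T, g x‖ ≤ δ * T + C * T₀ := by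
  have hi : ∀ u v, IntervalIntegrable g volume u v := fun u v => hg.intervalIntegrable u v
  have hδ0 : 0 ≤ δ := by
    have := (norm_nonneg _).trans (hδ 0)
    exact nonneg_of_mul_nonneg_left this hT₀
  have hC0 : 0 ≤ C := (norm_nonneg _).trans (hC 0)
  have hblock (n : ℕ) : ‖∫ x in (0 : ℝ)..(n * T₀), g x‖ ≤ n * (δ * T₀) := by
    induction n with
    | zero => simp
    | succ n ih =>
      rw [← intervalIntegral.integral_add_adjacent_intervals (hi 0 (n * T₀)) (hi _ _)]
      have h1 := hδ (n * T₀)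
      rw [show (n : ℝ) * T₀ + T₀ = ((n + 1 : ℕ) : ℝ) * T₀ by push_cast; ring] at h1
      refine (norm_add_le _ _).trans ?_
      push_cast at h1 ⊢
      linarith
  set n := ⌊T / T₀⌋₊
  have hn1 : n * T₀ ≤ T := by
    rw [← le_div_iff₀ hT₀]
    exact Nat.floor_le (by positivity)
  have hn2 : T ≤ n * T₀ + T₀ := by
    have := (Nat.lt_floor_add_one (T / T₀)).le
    rw [div_le_iff₀ hT₀] at this
    linarith
  rw [← intervalIntegral.integral_add_adjacent_intervals (hi 0 (n * T₀)) (hi _ T)]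
  have h2 := intervalIntegral.norm_integral_le_of_norm_le_const (a := n * T₀) (b := T)
      (f := g) (C := C) fun x _ => hC x
  rw [abs_of_nonneg (by linarith)] at h2
  have h3 : C * (T - n * T₀) ≤ C * T₀ := mul_le_mul_of_nonneg_left (by linarith) hC0
  have h4 : n * (δ * T₀) ≤ δ * T := by nlinarith
  exact (norm_add_le _ _).trans (by linarith [hblock n])

lemma APR.exists_locally_uniform_mean {f : ℝ → ℂ} (hf : APR f) {lam : ℝ}
    (hm : HasMeanR f lam 0) {ε : ℝ} (hε : 0 < ε) :
    ∃ δ > (0 : ℝ), ∃ T₁ : ℝ, ∀ μ, |μ - lam| < δ → ∀ T ≥ T₁,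
      ‖∫ x in (0 : ℝ)..T, f x * expChar μ x‖ ≤ ε * T := by
  obtain ⟨C, hC0, hC⟩ := hf.bounded
  obtain ⟨T₀, hT₀, h⟩ := hf.exists_uniform_mean hm (ε := ε / 3) (by positivity)
  have hpi := Real.pi_pos
  refine ⟨ε / (3 * (2 * Real.pi * T₀ * C)), by positivity, max 0 (3 * C * T₀ / ε),
    fun μ hμ T hT => ?_⟩
  have hblock (a : ℝ) : ‖∫ x in a..(a + T₀), f x * expChar μ x‖ ≤ 2 * ε / 3 * T₀ := by
    have e (ν : ℝ) : ‖∫ x in a..(a + T₀), f x * expChar ν x‖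
        = ‖∫ x in (0 : ℝ)..T₀, f (x + a) * expChar ν x‖ := by
      have := integral_shift_mul_expChar f ν 0 T₀ a
      rw [zero_add, add_comm T₀ a] at this
      rw [this, norm_mul, norm_expChar, one_mul]
    have hc (ν : ℝ) : Continuous fun x => f (x + a) * expChar ν x :=
      (hf.1.comp (by fun_prop : Continuous fun x => x + a)).mul (continuous_expChar ν)
    have h1 := h a
    rw [e] at h1 ⊢
    have h2 : ‖(∫ x in (0 : ℝ)..T₀, f (x + a) * expChar μ x)
        - ∫ x in (0 : ℝ)..T₀, f (x + a) * expChar lam x‖ ≤ ε / 3 * T₀ := by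
      rw [← intervalIntegral.integral_sub ((hc μ).intervalIntegrable _ _)
        ((hc lam).intervalIntegrable _ _)]
      have := intervalIntegral.norm_integral_le_of_norm_le_const (a := 0) (b := T₀)
        (f := fun x => f (x + a) * expChar μ x - f (x + a) * expChar lam x) (C := ε / 3) (by
          intro x hx
          rw [uIoc_of_le hT₀.le] at hx
          rw [← mul_sub, norm_mul]
          calc ‖f (x + a)‖ * ‖expChar μ x - expChar lam x‖
              ≤ C * (2 * Real.pi * (ε / (3 * (2 * Real.pi * T₀ * C))) * T₀) := by
                refine mul_le_mul (hC _) ((norm_expChar_sub_le _ _ _).trans ?_)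
                  (norm_nonneg _) hC0.le
                have : |x| ≤ T₀ := by rw [abs_of_pos hx.1]; exact hx.2
                gcongr
            _ = ε / 3 := by field_simp)
      rwa [sub_zero, abs_of_pos hT₀] at this
    have h3 := norm_le_norm_add_norm_sub' (∫ x in (0 : ℝ)..T₀, f (x + a) * expChar μ x)
      (∫ x in (0 : ℝ)..T₀, f (x + a) * expChar lam x)
    linarith
  have hT0 : 0 ≤ T := (le_max_left _ _).trans hT
  have hT1 : 3 * C * T₀ ≤ T * ε := by
    rw [← div_le_iff₀ hε]; exact (le_max_right _ _).trans hT
  have := norm_integral_le_of_blocks (g := fun x => f x * expChar μ x)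
    (hf.1.mul (continuous_expChar μ)) hT₀ (C := C) (fun x => by rw [norm_mul, norm_expChar, mul_one]; exact hC x) hblock hT0
  linarith

lemma APR.exists_large_frequency {f : ℝ → ℂ} (hf : APR f) {ε : ℝ} (hε : 0 < ε) :
    ∃ Λ T₁ : ℝ, ∀ μ, Λ ≤ |μ| → ∀ T ≥ T₁,
      ‖∫ x in (0 : ℝ)..T, f x * expChar μ x‖ ≤ ε * T := by
  obtain ⟨C, hC0, hC⟩ := hf.bounded
  obtain ⟨w, hw, h⟩ := hf.exists_small_shift hε
  refine ⟨1 / (2 * w), max 0 (2 * C * w / ε), fun μ hμ T hT => ?_⟩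
  have hT0 : 0 ≤ T := (le_max_left _ _).trans hT
  have hT1 : 2 * C * w ≤ T * ε := by
    rw [← div_le_iff₀ hε]; exact (le_max_right _ _).trans hT
  have hμ0 : μ ≠ 0 := by
    rintro rfl
    rw [abs_zero] at hμ
    have : 0 < 1 / (2 * w) := by positivity
    linarith
  set s : ℝ := 1 / (2 * μ) with hs
  have hsw : |s| ≤ w := by
    rw [hs, abs_div, abs_one, abs_mul, abs_two, div_le_iff₀ (by positivity)]
    rw [div_le_iff₀ (by positivity)] at hμ
    linarith
  have hchar : expChar μ s = -1 := by
    rw [expChar, show -(2 * (Real.pi : ℂ) * Complex.I * (μ : ℂ) * (s : ℂ))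
      = -(Real.pi * Complex.I) by
        have : (μ : ℂ) ≠ 0 := by exact_mod_cast hμ0
        rw [hs]; push_cast; field_simp, Complex.exp_neg, Complex.exp_pi_mul_I]
    norm_num
  have hc (t : ℝ) : Continuous fun x => f (x + t) * expChar μ x :=
      (hf.1.comp (by fun_prop : Continuous fun x => x + t)).mul (continuous_expChar μ)
  have hc0 : Continuous fun x => f x * expChar μ x := hf.1.mul (continuous_expChar μ)
  have hi : ∀ u v, IntervalIntegrable (fun x => f x * expChar μ x) volume u v :=
    fun u v => hc0.intervalIntegrable u v
  have e1 := integral_shift_mul_expChar f μ 0 T s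
  rw [hchar, zero_add] at e1
  have e2 : ∫ x in s..(T + s), f x * expChar μ x
      = (∫ x in (0 : ℝ)..T, f x * expChar μ x) - (∫ x in (0 : ℝ)..s, f x * expChar μ x)
        + ∫ x in T..(T + s), f x * expChar μ x := by
    rw [← intervalIntegral.integral_add_adjacent_intervals (hi s 0) (hi 0 (T + s)),
      ← intervalIntegral.integral_add_adjacent_intervals (hi 0 T) (hi T (T + s)),
      intervalIntegral.integral_symm 0 s]
    ring
  have e3 := intervalIntegral.integral_sub (hc0.intervalIntegrable 0 T)
    ((hc s).intervalIntegrable (μ := volume) 0 T)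
  have n1 := norm_integral_mul_expChar_le hC μ 0 s
  have n2 := norm_integral_mul_expChar_le hC μ T (T + s)
  have n3 := intervalIntegral.norm_integral_le_of_norm_le_const (a := 0) (b := T)
    (f := fun x => f x * expChar μ x - f (x + s) * expChar μ x) (C := ε) fun x _ => by
      rw [← sub_mul, norm_mul, norm_expChar, mul_one]; exact h s hsw x
  rw [sub_zero, abs_of_nonneg hT0] at n3
  rw [sub_zero] at n1
  rw [add_sub_cancel_left] at n2
  have e4 : (2 : ℂ) * ∫ x in (0 : ℝ)..T, f x * expChar μ x
      = (∫ x in (0 : ℝ)..T, f x * expChar μ x - f (x + s) * expChar μ x)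
        + (∫ x in (0 : ℝ)..s, f x * expChar μ x)
        + -∫ x in T..(T + s), f x * expChar μ x := by
    rw [e3]
    linear_combination e1 - e2
  have n4 := congrArg norm e4
  rw [norm_mul, Complex.norm_ofNat] at n4
  have n5 := norm_add₃_le (a := ∫ x in (0 : ℝ)..T, f x * expChar μ x - f (x + s) * expChar μ x)
    (b := ∫ x in (0 : ℝ)..s, f x * expChar μ x) (c := -∫ x in T..(T + s), f x * expChar μ x)
  rw [norm_neg] at n5
  have n6 := mul_le_mul_of_nonneg_left hsw hC0.le
  linarith

/-- If all Bohr means of an almost periodic function vanish, then they do so uniformly in the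
frequency. -/
lemma APR.exists_mean_uniform_in_frequency {f : ℝ → ℂ} (hf : APR f)
    (hm : ∀ lam, HasMeanR f lam 0) {ε : ℝ} (hε : 0 < ε) :
    ∃ T₁ : ℝ, ∀ μ, ∀ T ≥ T₁, ‖∫ x in (0 : ℝ)..T, f x * expChar μ x‖ ≤ ε * T := by
  obtain ⟨Λ, T₂, h2⟩ := hf.exists_large_frequency hε
  have hK : ∃ T₁ : ℝ, ∀ μ ∈ Icc (-Λ) Λ, ∀ T ≥ T₁,
      ‖∫ x in (0 : ℝ)..T, f x * expChar μ x‖ ≤ ε * T := by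
    refine (isCompact_Icc (a := -Λ) (b := Λ)).induction_on
      (p := fun s => ∃ T₁ : ℝ, ∀ μ ∈ s, ∀ T ≥ T₁,
        ‖∫ x in (0 : ℝ)..T, f x * expChar μ x‖ ≤ ε * T) ?_ ?_ ?_ ?_
    · exact ⟨0, fun μ hμ => hμ.elim⟩
    · rintro s t hst ⟨T₁, h⟩
      exact ⟨T₁, fun μ hμ => h μ (hst hμ)⟩
    · rintro s t ⟨T₁, h⟩ ⟨T₃, h'⟩
      refine ⟨max T₁ T₃, fun μ hμ T hT => ?_⟩
      rcases hμ with hμ | hμ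
      · exact h μ hμ T ((le_max_left _ _).trans hT)
      · exact h' μ hμ T ((le_max_right _ _).trans hT)
    · intro lam _
      obtain ⟨δ, hδ, T₁, h⟩ := hf.exists_locally_uniform_mean (hm lam) hε
      exact ⟨Metric.ball lam δ, mem_nhdsWithin_of_mem_nhds (Metric.ball_mem_nhds _ hδ), T₁,
        fun μ hμ => h μ (by rwa [Metric.mem_ball, Real.dist_eq] at hμ)⟩
  obtain ⟨T₁, h1⟩ := hK
  refine ⟨max T₁ T₂, fun μ T hT => ?_⟩
  rcases le_total Λ |μ| with h | h
  · exact h2 μ h T ((le_max_right _ _).trans hT)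
  · exact h1 μ (abs_le.1 h) T ((le_max_left _ _).trans hT)

lemma le_integral_of_relDense_blocks {q : ℝ → ℝ} (hq : ∀ x, 0 ≤ q x)
    (hi : ∀ u v, IntervalIntegrable q volume u v) {L w c : ℝ} (hL : 0 < L) (hw : 0 ≤ w)
    (hc : 0 ≤ c) (h : ∀ a, ∃ b, a ≤ b ∧ b + w ≤ a + L ∧ ∀ x ∈ Icc b (b + w), c ≤ q x)
    (a : ℝ) {T : ℝ} (hT : L ≤ T) :
    c * w / (2 * L) * T ≤ ∫ x in a..(a + T), q x := by
  have hblock (a : ℝ) : c * w ≤ ∫ x in a..(a + L), q x := by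
    obtain ⟨b, h1, h2, h3⟩ := h a
    calc c * w = ∫ _ in b..(b + w), c := by simp [mul_comm]
      _ ≤ ∫ x in b..(b + w), q x :=
        intervalIntegral.integral_mono_on (by linarith) (by simp) (hi _ _) h3
      _ ≤ ∫ x in a..(a + L), q x :=
        intervalIntegral.integral_mono_interval h1 (by linarith) h2
          (Eventually.of_forall hq) (hi _ _)
  have hblocks (n : ℕ) : n * (c * w) ≤ ∫ x in a..(a + n * L), q x := by
    induction n with
    | zero => simp
    | succ n ih =>
      rw [← intervalIntegral.integral_add_adjacent_intervals (hi a (a + n * L)) (hi _ _)]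
      have h1 := hblock (a + n * L)
      rw [show a + (n : ℝ) * L + L = a + ((n + 1 : ℕ) : ℝ) * L by push_cast; ring] at h1
      push_cast at h1 ⊢
      linarith
  have hT0 : 0 < T := hL.trans_le hT
  set n := ⌊T / L⌋₊
  have hn1 : n * L ≤ T := by
    rw [← le_div_iff₀ hL]
    exact Nat.floor_le (by positivity)
  have hn2 : T ≤ n * (2 * L) := by
    have h1 := (Nat.lt_floor_add_one (T / L)).le
    rw [div_le_iff₀ hL] at h1
    have h2 : (1 : ℝ) ≤ n := by
      exact_mod_cast Nat.le_floor (by rw [Nat.cast_one, le_div_iff₀ hL]; linarith)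
    nlinarith
  calc c * w / (2 * L) * T ≤ c * w / (2 * L) * (n * (2 * L)) := by gcongr
    _ = n * (c * w) := by field_simp
    _ ≤ ∫ x in a..(a + n * L), q x := hblocks n
    _ ≤ ∫ x in a..(a + T), q x :=
        intervalIntegral.integral_mono_interval le_rfl (by have : 0 ≤ n * L := by positivity
                                                           linarith) (by linarith)
          (Eventually.of_forall hq) (hi _ _)

lemma integrable_mul_expChar {k : ℝ → ℂ} (hk : Integrable k) (lam : ℝ) :
    Integrable fun x => k x * expChar lam x :=
  hk.mul_bdd (c := 1) (continuous_expChar lam).aestronglyMeasurable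
    (Eventually.of_forall fun x => (norm_expChar lam x).le)

lemma integral_convolution_mul_expChar {k φ : ℝ → ℂ} (hk : Integrable k) (hφ : Integrable φ)
    (lam : ℝ) :
    ∫ x, (∫ s, k s * φ (x - s)) * expChar lam x
      = (∫ x, k x * expChar lam x) * ∫ x, φ x * expChar lam x := by
  have := integral_convolution (ContinuousLinearMap.mul ℝ ℂ)
    (integrable_mul_expChar hk lam) (integrable_mul_expChar hφ lam)
  simp only [convolution_def, ContinuousLinearMap.mul_apply'] at this
  rw [← this]
  congr 1 with x
  rw [← integral_mul_const]
  congr 1 with s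
  have : expChar lam x = expChar lam s * expChar lam (x - s) := by
    rw [← expChar_add]; congr 1; ring
  rw [this]
  ring

lemma fourierCoeffOn_eq_integral_expChar {P : ℝ} (hP : 0 < P) {g : ℝ → ℂ}
    (hg : ∀ x, x ∉ Ioc 0 P → g x = 0) (n : ℤ) :
    fourierCoeffOn hP g n = (1 / P : ℝ) • ∫ x, g x * expChar (n / P) x := by
  rw [fourierCoeffOn_eq_integral, sub_zero, intervalIntegral.integral_of_le hP.le]
  congr 1
  rw [← setIntegral_eq_integral_of_forall_compl_eq_zero (s := Ioc 0 P)
    (f := fun x => g x * expChar (n / P) x) fun x hx => by rw [hg x hx, zero_mul]]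
  congr 1 with x
  rw [fourier_coe_apply, smul_eq_mul, mul_comm, expChar]
  congr 2
  push_cast
  field_simp

/-- Convolution with `k` has `L²` norm at most `sup |φ̂|` times that of `k`. -/
lemma integral_sq_convolution_le {k φ : ℝ → ℂ} (hk : Integrable k) (hφ : Integrable φ)
    {A B M C D : ℝ} (hA : 0 < A) (hB : 0 < B)
    (hkA : ∀ x, x ∉ Ioc 0 A → k x = 0) (hφB : ∀ x, x ∉ Ioc 0 B → φ x = 0)
    (hC : ∀ x, ‖φ x‖ ≤ C) (hD : ∀ x, ‖k x‖ ≤ D)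
    (hM : ∀ lam, ‖∫ x, φ x * expChar lam x‖ ≤ M) :
    IntervalIntegrable (fun x => ‖∫ s, k s * φ (x - s)‖ ^ 2) volume 0 (A + B) ∧
    ∫ x in (0 : ℝ)..(A + B), ‖∫ s, k s * φ (x - s)‖ ^ 2
      ≤ M ^ 2 * ∫ x in (0 : ℝ)..(A + B), ‖k x‖ ^ 2 := by
  have hP : 0 < A + B := by positivity
  set h : ℝ → ℂ := fun x => ∫ s, k s * φ (x - s) with hh
  have hmeas : AEStronglyMeasurable h volume :=
    (Integrable.integrable_convolution (ContinuousLinearMap.mul ℝ ℂ) hk hφ).aestronglyMeasurable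
  have hsupp : ∀ x, x ∉ Ioc 0 (A + B) → h x = 0 := by
    intro x hx
    rw [hh]
    refine integral_eq_zero_of_ae (Eventually.of_forall fun s => ?_)
    by_cases hs : s ∈ Ioc 0 A
    · refine mul_eq_zero_of_right _ (hφB (x - s) ?_)
      intro hxs
      exact hx ⟨by linarith [hs.1, hxs.1], by linarith [hs.2, hxs.2]⟩
    · exact mul_eq_zero_of_left (hkA s hs) _
  have hbound : ∀ x, ‖h x‖ ≤ ∫ s, ‖k s‖ * C := fun x =>
    norm_integral_le_of_norm_le (hk.norm.mul_const C) (Eventually.of_forall fun s => by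
      rw [norm_mul]; exact mul_le_mul_of_nonneg_left (hC _) (norm_nonneg _))
  have hkL2 : MemLp k 2 (volume.restrict (Ioc 0 (A + B))) :=
    MemLp.of_bound hk.aestronglyMeasurable.restrict D (Eventually.of_forall hD)
  have hhL2 : MemLp h 2 (volume.restrict (Ioc 0 (A + B))) :=
    MemLp.of_bound hmeas.restrict _ (Eventually.of_forall hbound)
  have hkA' : ∀ x, x ∉ Ioc 0 (A + B) → k x = 0 := fun x hx =>
    hkA x fun hx' => hx ⟨hx'.1, by linarith [hx'.2]⟩
  refine ⟨(intervalIntegrable_iff_integrableOn_Ioc_of_le hP.le).2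
    (hhL2.integrable_norm_pow two_ne_zero), ?_⟩
  have sk := hasSum_sq_fourierCoeffOn hP hkL2
  have sh := hasSum_sq_fourierCoeffOn hP hhL2
  have hle : ∀ n : ℤ, ‖fourierCoeffOn hP h n‖ ^ 2 ≤ M ^ 2 * ‖fourierCoeffOn hP k n‖ ^ 2 := by
    intro n
    rw [fourierCoeffOn_eq_integral_expChar hP hsupp, fourierCoeffOn_eq_integral_expChar hP hkA',
      ← mul_pow]
    rw [integral_convolution_mul_expChar hk hφ, norm_smul, norm_smul, norm_mul]
    have h1 : ‖∫ x, k x * expChar (n / (A + B)) x‖ * ‖∫ x, φ x * expChar (n / (A + B)) x‖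
        ≤ ‖∫ x, k x * expChar (n / (A + B)) x‖ * M :=
      mul_le_mul_of_nonneg_left (hM _) (norm_nonneg _)
    refine pow_le_pow_left₀ (by positivity) ?_ 2
    calc _ ≤ ‖(1 / (A + B) : ℝ)‖ * (‖∫ x, k x * expChar (n / (A + B)) x‖ * M) :=
          mul_le_mul_of_nonneg_left h1 (norm_nonneg _)
      _ = _ := by ring
  have := hasSum_le hle sh (sk.mul_left (M ^ 2))
  simp only [sub_zero, smul_eq_mul] at this
  have hP' : 0 < (A + B)⁻¹ := by positivity
  nlinarith

lemma APR.exists_blocks_norm_ge {f : ℝ → ℂ} (hf : APR f) {x₀ : ℝ} (hx₀ : f x₀ ≠ 0) :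
    ∃ L > (0 : ℝ), ∃ w > (0 : ℝ), ∃ c > (0 : ℝ), ∀ a, ∃ b, a ≤ b ∧ b + w ≤ a + L ∧
      ∀ x ∈ Icc b (b + w), c ≤ ‖f x‖ ^ 2 := by
  have hr : 0 < ‖f x₀‖ / 4 := by positivity
  obtain ⟨w, hw, h1⟩ := hf.exists_small_shift hr
  obtain ⟨l, hl, h2⟩ := hf.exists_shift hr
  refine ⟨l + 2 * w, by positivity, 2 * w, by positivity, (‖f x₀‖ / 4) ^ 2, by positivity,
    fun a => ?_⟩
  obtain ⟨t, ht1, ht2, ht⟩ := h2 (a - x₀ + w)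
  refine ⟨x₀ + t - w, by linarith, by linarith, fun x hx => ?_⟩
  have e1 := h1 (x - x₀ - t) (abs_le.2 ⟨by linarith [hx.1], by linarith [hx.2]⟩) x₀
  have e2 := ht (x - t)
  rw [show x₀ + (x - x₀ - t) = x - t by ring] at e1
  rw [sub_add_cancel] at e2
  have e3 := norm_le_norm_add_norm_sub' (f x₀) (f (x - t))
  have e4 := norm_le_norm_add_norm_sub' (f (x - t)) (f x)
  exact pow_le_pow_left₀ hr.le (by linarith) 2

lemma APR.exists_blocks_almostPeriod {f : ℝ → ℂ} (hf : APR f) {δ : ℝ} (hδ : 0 < δ) :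
    ∃ L > (0 : ℝ), ∃ w > (0 : ℝ), ∀ a, ∃ b, a ≤ b ∧ b + w ≤ a + L ∧
      ∀ s ∈ Icc b (b + w), ∀ x, ‖f x - f (x + s)‖ ≤ δ := by
  obtain ⟨w, hw, h1⟩ := hf.exists_small_shift (half_pos hδ)
  obtain ⟨l, hl, h2⟩ := hf.exists_shift (half_pos hδ)
  refine ⟨l + 2 * w, by positivity, 2 * w, by positivity, fun a => ?_⟩
  obtain ⟨t, ht1, ht2, ht⟩ := h2 (a + w)
  refine ⟨t - w, by linarith, by linarith, fun s hs x => ?_⟩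
  have e1 := h1 (s - t) (abs_le.2 ⟨by linarith [hs.1], by linarith [hs.2]⟩) (x + t)
  rw [show x + t + (s - t) = x + s by ring] at e1
  calc _ ≤ ‖f x - f (x + t)‖ + ‖f (x + t) - f (x + s)‖ := norm_sub_le_norm_sub_add_norm_sub _ _ _
    _ ≤ δ := by linarith [ht x]

/-- The uniqueness theorem: an almost periodic function whose Bohr means all vanish is zero. -/
theorem APR.eq_zero_of_hasMeanR_zero {f : ℝ → ℂ} (hf : APR f)
    (hm : ∀ lam, HasMeanR f lam 0) (x : ℝ) : f x = 0 := by
  by_contra hx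
  obtain ⟨C, hC0, hC⟩ := hf.bounded
  obtain ⟨L₁, hL₁, w₁, hw₁, c, hc, hblock₁⟩ := hf.exists_blocks_norm_ge hx
  set c₁ := c * w₁ / (2 * L₁) with hc₁
  have hc₁0 : 0 < c₁ := by positivity
  set δ := √c₁ / 2 with hδdef
  have hδ : 0 < δ := by positivity
  have hδ2 : 4 * δ ^ 2 = c₁ := by
    rw [hδdef, div_pow, Real.sq_sqrt hc₁0.le]; ring
  obtain ⟨L₂, hL₂, w₂, hw₂, hblock₂⟩ := hf.exists_blocks_almostPeriod hδ
  set β := 1 * w₂ / (2 * L₂) with hβ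
  have hβ0 : 0 < β := by positivity
  set ε := √(β * c₁ / 32) with hεdef
  have hε : 0 < ε := by positivity
  have hε2 : 32 * ε ^ 2 = β * c₁ := by
    rw [hεdef, Real.sq_sqrt (by positivity)]; ring
  obtain ⟨T₁, hT₁⟩ := hf.exists_mean_uniform_in_frequency hm hε
  obtain ⟨R, hRL₁, hRL₂, hRT, hR1⟩ : ∃ R : ℝ, L₁ ≤ R ∧ L₂ ≤ R ∧ T₁ ≤ R ∧ 1 ≤ R :=
    ⟨max (max L₁ L₂) (max T₁ 1), by simp, by simp, by simp, by simp⟩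
  have hR : 0 < R := by linarith
  set S : Set ℝ := {s | ∀ x, ‖f x - f (x + s)‖ ≤ δ} with hS
  have hSm : MeasurableSet S := by
    refine IsClosed.measurableSet ?_
    rw [hS, ofPred_forall]
    refine isClosed_iInter fun x => isClosed_le ?_ continuous_const
    exact (continuous_const.sub (hf.1.comp (by fun_prop : Continuous fun s => x + s))).norm
  set kr : ℝ → ℝ := (Ioc 0 R ∩ S).indicator 1 with hkr
  set k : ℝ → ℂ := fun s => (kr s : ℂ) with hk
  set φ : ℝ → ℂ := (Ioc 0 (2 * R)).indicator f with hφ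
  have hkr0 : ∀ s, 0 ≤ kr s := fun s => indicator_nonneg (fun _ _ => zero_le_one) s
  have hkr1 : ∀ s, kr s ≤ 1 := fun s => indicator_le_self' (fun _ _ => zero_le_one) s
  have hkrsq : ∀ s, kr s ^ 2 = kr s := fun s => by
    by_cases hs : s ∈ Ioc 0 R ∩ S <;> simp [hkr, hs]
  have hkri : Integrable kr := by
    rw [hkr, integrable_indicator_iff (measurableSet_Ioc.inter hSm)]
    exact integrableOn_const (C := (1 : ℝ))
      ((measure_mono inter_subset_left).trans_lt measure_Ioc_lt_top).ne
  have hki : Integrable k := hkri.ofReal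
  have hφi : Integrable φ := by
    rw [hφ, integrable_indicator_iff measurableSet_Ioc]
    exact (hf.1.integrableOn_Icc).mono_set Ioc_subset_Icc_self
  have hkA : ∀ s, s ∉ Ioc 0 R → kr s = 0 := fun s hs =>
    indicator_of_notMem (fun h => hs h.1) _
  set κ := ∫ s, kr s with hκ
  have hκ1 : ∀ P, R ≤ P → ∫ s in (0 : ℝ)..P, kr s = κ := by
    intro P hP
    rw [intervalIntegral.integral_of_le (by linarith),
      setIntegral_eq_integral_of_forall_compl_eq_zero]
    exact fun s hs => hkA s fun hs' => hs ⟨hs'.1, hs'.2.trans hP⟩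
  have hκβ : β * R ≤ κ := by
    have hqi : ∀ u v, IntervalIntegrable (S.indicator (1 : ℝ → ℝ)) volume u v := by
      refine fun u v => ⟨?_, ?_⟩ <;>
      exact (integrableOn_const (C := (1 : ℝ)) measure_Ioc_lt_top.ne).indicator hSm
    have h1 := le_integral_of_relDense_blocks (q := S.indicator 1) (c := 1)
      (fun s => indicator_nonneg (fun _ _ => zero_le_one) s) hqi hL₂ hw₂.le zero_le_one
      (fun a => by
        obtain ⟨b, h1, h2, h3⟩ := hblock₂ a
        exact ⟨b, h1, h2, fun s hs => by
          rw [indicator_of_mem (show s ∈ S from h3 s hs), Pi.one_apply]⟩) 0 hRL₂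
    rw [zero_add] at h1
    refine h1.trans (le_of_eq ?_)
    rw [← hκ1 R le_rfl, intervalIntegral.integral_of_le hR.le,
      intervalIntegral.integral_of_le hR.le]
    refine setIntegral_congr_fun measurableSet_Ioc fun s hs => ?_
    by_cases hsS : s ∈ S <;> simp [hkr, hs.1, hs.2, hsS]
  have hκ0 : 0 < κ := lt_of_lt_of_le (by positivity) hκβ
  have hM : ∀ lam, ‖∫ x, φ x * expChar lam x‖ ≤ ε * (2 * R) := by
    intro lam
    have h1 := hT₁ lam (2 * R) (by linarith)
    rw [intervalIntegral.integral_of_le (by linarith), ← integral_indicator measurableSet_Ioc]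
      at h1
    refine le_of_eq_of_le ?_ h1
    congr 2 with x
    by_cases hx : x ∈ Ioc 0 (2 * R) <;> simp [hφ, hx]
  obtain ⟨hhi, hconv⟩ := integral_sq_convolution_le hki hφi hR (by positivity : 0 < 2 * R)
    (fun s hs => by simp only [hk, hkA s hs, Complex.ofReal_zero])
    (fun s hs => indicator_of_notMem hs _) (C := C) (D := 1)
    (fun x => (norm_indicator_le_norm_self _ _).trans (hC x))
    (fun s => by rw [hk, Complex.norm_real, Real.norm_of_nonneg (hkr0 s)]; exact hkr1 s) hM
  set h : ℝ → ℂ := fun x => ∫ s, k s * φ (x - s) with hh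
  have hknorm : ∫ s in (0 : ℝ)..(R + 2 * R), ‖k s‖ ^ 2 = κ := by
    rw [← hκ1 (R + 2 * R) (by linarith)]
    congr 1 with s
    rw [hk, Complex.norm_real, Real.norm_of_nonneg (hkr0 s), hkrsq]
  rw [hknorm] at hconv
  have hfh : ∀ x ∈ Ioo R (R + R), κ ^ 2 * ‖f x‖ ^ 2 ≤ 2 * ‖h x‖ ^ 2 + 2 * δ ^ 2 * κ ^ 2 := by
    intro x hx
    have h1 : ‖h x - κ * f x‖ ≤ κ * δ := by
      have e1 : h x - κ * f x = ∫ s, k s * (φ (x - s) - f x) := by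
        have i1 : Integrable fun s => k s * φ (x - s) :=
          hki.mul_bdd (c := C) (hφi.comp_sub_left x).aestronglyMeasurable
            (Eventually.of_forall fun s => (norm_indicator_le_norm_self _ _).trans (hC _))
        have e2 : (κ : ℂ) * f x = ∫ s, k s * f x := by
          rw [integral_mul_const, hκ, hk, integral_complex_ofReal]
        rw [e2, hh, ← integral_sub i1 (hki.mul_const _)]
        congr 1 with s
        ring
      rw [e1, hκ, ← integral_mul_const]
      refine norm_integral_le_of_norm_le (hkri.mul_const δ) (Eventually.of_forall fun s => ?_)
      rw [norm_mul, hk, Complex.norm_real, Real.norm_of_nonneg (hkr0 s)]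
      by_cases hs : s ∈ Ioc 0 R ∩ S
      · refine mul_le_mul_of_nonneg_left ?_ (hkr0 s)
        have h2 : x - s ∈ Ioc 0 (2 * R) :=
          ⟨by linarith [hs.1.2, hx.1], by linarith [hs.1.1, hx.2]⟩
        have h3 := hs.2 (x - s)
        rw [sub_add_cancel] at h3
        rwa [hφ, indicator_of_mem h2]
      · rw [hkr, indicator_of_notMem hs, zero_mul, zero_mul]
    have h2 : κ * ‖f x‖ ≤ ‖h x‖ + κ * δ := by
      have := norm_le_norm_add_norm_sub (h x) (κ * f x)
      rw [norm_mul, Complex.norm_real, Real.norm_of_nonneg hκ0.le] at this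
      linarith
    have h3 : (κ * ‖f x‖) ^ 2 ≤ (‖h x‖ + κ * δ) ^ 2 := pow_le_pow_left₀ (by positivity) h2 2
    nlinarith [sq_nonneg (‖h x‖ - κ * δ)]
  have hlow := le_integral_of_relDense_blocks (q := fun x => ‖f x‖ ^ 2) (fun x => by positivity)
    (fun u v => (hf.1.norm.pow 2).intervalIntegrable u v) hL₁ hw₁.le hc.le hblock₁ R hRL₁
  have hhi' : IntervalIntegrable (fun x => ‖h x‖ ^ 2) volume R (R + R) := by
    refine hhi.mono_set ?_
    rw [uIcc_of_le (by linarith), uIcc_of_le (by linarith)]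
    exact Icc_subset_Icc hR.le (by linarith)
  have hint : κ ^ 2 * ∫ x in R..(R + R), ‖f x‖ ^ 2
      ≤ 2 * (∫ x in R..(R + R), ‖h x‖ ^ 2) + 2 * δ ^ 2 * κ ^ 2 * R := by
    have := intervalIntegral.integral_mono_on_of_le_Ioo (by linarith : R ≤ R + R)
      (((hf.1.norm.pow 2).const_mul (κ ^ 2)).intervalIntegrable R (R + R))
      ((hhi'.const_mul 2).add (intervalIntegrable_const (c := 2 * δ ^ 2 * κ ^ 2))) hfh
    rw [intervalIntegral.integral_add (hhi'.const_mul 2) intervalIntegrable_const,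
      intervalIntegral.integral_const_mul, intervalIntegral.integral_const_mul,
      intervalIntegral.integral_const, smul_eq_mul] at this
    simp only [Pi.pow_apply] at this
    linarith
  have hmono : ∫ x in R..(R + R), ‖h x‖ ^ 2 ≤ ∫ x in (0 : ℝ)..(R + 2 * R), ‖h x‖ ^ 2 :=
    intervalIntegral.integral_mono_interval hR.le (by linarith) (by linarith)
      (Eventually.of_forall fun x => by positivity) hhi
  have h1 : κ ^ 2 * (c₁ * R) ≤ 2 * ((ε * (2 * R)) ^ 2 * κ) + 2 * δ ^ 2 * κ ^ 2 * R := by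
    have := mul_le_mul_of_nonneg_left hlow (by positivity : 0 ≤ κ ^ 2)
    linarith
  have h2 : κ * R * (κ * c₁) ≤ κ * R * (16 * ε ^ 2 * R) := by
    have e : 2 * δ ^ 2 * κ ^ 2 * R = κ ^ 2 * (c₁ * R) / 2 := by rw [← hδ2]; ring
    rw [e] at h1
    linarith
  have h3 := le_of_mul_le_mul_left h2 (by positivity)
  have h4 : β * R * c₁ ≤ κ * c₁ := mul_le_mul_of_nonneg_right hκβ hc₁0.le
  have h5 : 0 < β * c₁ * R := by positivity
  have h6 : 16 * ε ^ 2 * R = β * c₁ * R / 2 := by rw [← hε2]; ring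
  linarith

/-- The Poisson kernel of the upper half-plane. -/
def halfPlanePoisson (y t : ℝ) : ℝ := y / (Real.pi * (y ^ 2 + t ^ 2))

lemma halfPlanePoisson_nonneg {y : ℝ} (hy : 0 < y) (t : ℝ) : 0 ≤ halfPlanePoisson y t := by
  unfold halfPlanePoisson
  positivity

lemma integrable_halfPlanePoisson {y : ℝ} (hy : 0 < y) : Integrable (halfPlanePoisson y) := by
  have h := (integrable_inv_one_add_sq.comp_div hy.ne').const_mul (1 / (Real.pi * y))
  refine h.congr (Eventually.of_forall fun t => ?_)
  simp only [halfPlanePoisson]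
  field_simp

lemma continuous_exp_neg_mul_abs (b : ℝ) : Continuous fun v : ℝ => cexp ((-(b * |v|) : ℝ) : ℂ) := by
  fun_prop

lemma integrableOn_Ioi_exp_neg_mul_abs {b : ℝ} (hb : 0 < b) :
    IntegrableOn (fun v : ℝ => cexp ((-(b * |v|) : ℝ) : ℂ)) (Ioi 0) := by
  refine (integrableOn_exp_mul_complex_Ioi (a := -b) (by simpa using hb) 0).congr_fun
    (fun v hv => ?_) measurableSet_Ioi
  simp only [abs_of_pos (mem_Ioi.1 hv)]
  push_cast
  ring_nf

lemma integrableOn_Iic_exp_neg_mul_abs {b : ℝ} (hb : 0 < b) :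
    IntegrableOn (fun v : ℝ => cexp ((-(b * |v|) : ℝ) : ℂ)) (Iic 0) := by
  refine (integrableOn_exp_mul_complex_Iic (a := b) (by simpa using hb) 0).congr_fun
    (fun v hv => ?_) measurableSet_Iic
  simp only [abs_of_nonpos (mem_Iic.1 hv)]
  push_cast
  ring_nf

lemma integrable_exp_neg_mul_abs {b : ℝ} (hb : 0 < b) :
    Integrable fun v : ℝ => cexp ((-(b * |v|) : ℝ) : ℂ) := by
  rw [← integrableOn_univ, ← Iic_union_Ioi (a := (0 : ℝ))]
  exact (integrableOn_Iic_exp_neg_mul_abs hb).union (integrableOn_Ioi_exp_neg_mul_abs hb)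

lemma integral_exp_neg_mul_abs_mul_expChar {y : ℝ} (hy : 0 < y) (w : ℝ) :
    ∫ v : ℝ, cexp ((-(2 * Real.pi * y * |v|) : ℝ) : ℂ) * expChar w v
      = halfPlanePoisson y w := by
  have hb : 0 < 2 * Real.pi * y := by positivity
  have hint : Integrable fun v : ℝ => cexp ((-(2 * Real.pi * y * |v|) : ℝ) : ℂ) * expChar w v :=
    integrable_mul_expChar (integrable_exp_neg_mul_abs hb) w
  have ha1 : ((-(2 * Real.pi * y) : ℝ) - (2 * Real.pi * w : ℝ) * Complex.I : ℂ).re < 0 := by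
    simp [Real.pi_pos, hy]
  have ha2 : 0 < ((2 * Real.pi * y : ℝ) - (2 * Real.pi * w : ℝ) * Complex.I : ℂ).re := by
    simp [Real.pi_pos, hy]
  have h1 : ∫ v in Ioi (0 : ℝ), cexp ((-(2 * Real.pi * y * |v|) : ℝ) : ℂ) * expChar w v
      = ∫ v in Ioi (0 : ℝ), cexp (((-(2 * Real.pi * y) : ℝ)
        - (2 * Real.pi * w : ℝ) * Complex.I : ℂ) * v) := by
    refine setIntegral_congr_fun measurableSet_Ioi fun v hv => ?_
    simp only [abs_of_pos (mem_Ioi.1 hv), expChar, ← Complex.exp_add]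
    congr 1
    push_cast
    ring
  have h2 : ∫ v in Iic (0 : ℝ), cexp ((-(2 * Real.pi * y * |v|) : ℝ) : ℂ) * expChar w v
      = ∫ v in Iic (0 : ℝ), cexp (((2 * Real.pi * y : ℝ)
        - (2 * Real.pi * w : ℝ) * Complex.I : ℂ) * v) := by
    refine setIntegral_congr_fun measurableSet_Iic fun v hv => ?_
    simp only [abs_of_nonpos (mem_Iic.1 hv), expChar, ← Complex.exp_add]
    congr 1
    push_cast
    ring
  rw [← intervalIntegral.integral_Iic_add_Ioi hint.integrableOn hint.integrableOn, h1, h2,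
    integral_exp_mul_complex_Ioi ha1, integral_exp_mul_complex_Iic ha2]
  have hn1 : ((-(2 * Real.pi * y) : ℝ) - (2 * Real.pi * w : ℝ) * Complex.I : ℂ) ≠ 0 :=
    fun h => by rw [h] at ha1; simp at ha1
  have hn2 : ((2 * Real.pi * y : ℝ) - (2 * Real.pi * w : ℝ) * Complex.I : ℂ) ≠ 0 :=
    fun h => by rw [h] at ha2; simp at ha2
  have hn3 : ((Real.pi * (y ^ 2 + w ^ 2) : ℝ) : ℂ) ≠ 0 := by
    exact_mod_cast (by positivity : Real.pi * (y ^ 2 + w ^ 2) ≠ 0)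
  simp only [Complex.ofReal_zero, mul_zero, Complex.exp_zero, halfPlanePoisson,
    Complex.ofReal_div]
  rw [div_add_div _ _ hn2 hn1, div_eq_div_iff (mul_ne_zero hn2 hn1) hn3]
  push_cast
  linear_combination (4 * (Real.pi : ℂ) ^ 2 * y * w ^ 2 * (-1)) * Complex.I_sq

lemma integral_halfPlanePoisson_mul_expChar {y : ℝ} (hy : 0 < y) (lam : ℝ) :
    ∫ t : ℝ, (halfPlanePoisson y t : ℂ) * expChar lam t
      = cexp ((-(2 * Real.pi * y * |lam|) : ℝ) : ℂ) := by
  set u : ℝ → ℂ := fun v => cexp ((-(2 * Real.pi * y * |v|) : ℝ) : ℂ) with hu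
  have hFT : FourierTransform.fourier u = fun w => (halfPlanePoisson y w : ℂ) := by
    ext w
    rw [Real.fourier_real_eq_integral_exp_smul, ← integral_exp_neg_mul_abs_mul_expChar hy]
    refine integral_congr_ae (Eventually.of_forall fun v => ?_)
    simp only [smul_eq_mul, hu, expChar]
    rw [mul_comm]
    congr 2
    push_cast
    ring
  have hinv := (continuous_exp_neg_mul_abs (2 * Real.pi * y)).fourierInv_fourier_eq
    (integrable_exp_neg_mul_abs (by positivity))
    (by
      change Integrable (FourierTransform.fourier u)
      rw [hFT]
      exact (integrable_halfPlanePoisson hy).ofReal)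
  have h := congrFun hinv (-lam)
  change FourierTransformInv.fourierInv (FourierTransform.fourier u) (-lam) = _ at h
  rw [hFT, Real.fourierInv_eq_fourier_neg, neg_neg, Real.fourier_real_eq_integral_exp_smul,
    abs_neg] at h
  rw [← h]
  refine integral_congr_ae (Eventually.of_forall fun v => ?_)
  simp only [smul_eq_mul, expChar]
  rw [mul_comm]
  congr 2
  push_cast
  ring

lemma integral_halfPlanePoisson {y : ℝ} (hy : 0 < y) : ∫ t : ℝ, halfPlanePoisson y t = 1 := by
  have h := integral_halfPlanePoisson_mul_expChar hy 0
  simp only [expChar, Complex.ofReal_zero, mul_zero, zero_mul, neg_zero, Complex.exp_zero,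
    mul_one, abs_zero] at h
  rw [integral_complex_ofReal] at h
  exact_mod_cast h

/-- The average of the translates of `g` with respect to the weight `k`. -/
def weightedAverage (k : ℝ → ℝ) (g : ℝ → ℂ) (x : ℝ) : ℂ := ∫ t, (k t : ℂ) * g (x - t)

section WeightedAverage

variable {k : ℝ → ℝ} {g : ℝ → ℂ} {C : ℝ}

lemma integrable_weightedAverage (hk : Integrable k) (hg : Continuous g) (hC : ∀ x, ‖g x‖ ≤ C)
    (x : ℝ) : Integrable fun t => (k t : ℂ) * g (x - t) :=
  hk.ofReal.mul_bdd (c := C) (hg.comp (by fun_prop)).aestronglyMeasurable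
    (Eventually.of_forall fun t => hC _)

lemma norm_integral_weight_mul_le (hk : Integrable k) (hk0 : ∀ t, 0 ≤ k t)
    (hk1 : ∫ t, k t = 1) {u : ℝ → ℂ} (hC : ∀ t, ‖u t‖ ≤ C) : ‖∫ t, (k t : ℂ) * u t‖ ≤ C := by
  refine (norm_integral_le_of_norm_le (hk.mul_const C) (Eventually.of_forall fun t => ?_)).trans
    (le_of_eq ?_)
  · rw [norm_mul, Complex.norm_real, Real.norm_of_nonneg (hk0 t)]
    exact mul_le_mul_of_nonneg_left (hC t) (hk0 t)
  · rw [integral_mul_const, hk1, one_mul]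

lemma weightedAverage_sub (hk : Integrable k) (hg : Continuous g) (hC : ∀ x, ‖g x‖ ≤ C)
    {g' : ℝ → ℂ} (hg' : Continuous g') {C' : ℝ} (hC' : ∀ x, ‖g' x‖ ≤ C') (x : ℝ) :
    weightedAverage k (fun x => g x - g' x) x = weightedAverage k g x - weightedAverage k g' x := by
  simp only [weightedAverage, mul_sub]
  exact integral_sub (integrable_weightedAverage hk hg hC x)
    (integrable_weightedAverage hk hg' hC' x)

lemma weightedAverage_const (hk1 : ∫ t, k t = 1) (c : ℂ) (x : ℝ) :
    weightedAverage k (fun _ => c) x = c := by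
  simp only [weightedAverage]
  rw [integral_mul_const, integral_complex_ofReal, hk1]
  simp

lemma continuous_weightedAverage (hk : Integrable k) (hg : Continuous g)
    (hC : ∀ x, ‖g x‖ ≤ C) : Continuous (weightedAverage k g) := by
  refine continuous_of_dominated (bound := fun t => ‖k t‖ * C)
    (fun x => (integrable_weightedAverage hk hg hC x).aestronglyMeasurable)
    (fun x => Eventually.of_forall fun t => ?_) (hk.norm.mul_const C)
    (Eventually.of_forall fun t => by fun_prop)
  rw [norm_mul, Complex.norm_real]
  exact mul_le_mul_of_nonneg_left (hC _) (norm_nonneg _)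

lemma norm_weightedAverage_sub_shift_le (hk : Integrable k) (hk0 : ∀ t, 0 ≤ k t)
    (hk1 : ∫ t, k t = 1) (hg : Continuous g) (hC : ∀ x, ‖g x‖ ≤ C) {s ε : ℝ}
    (hs : ∀ x, ‖g x - g (x + s)‖ ≤ ε) (x : ℝ) :
    ‖weightedAverage k g x - weightedAverage k g (x + s)‖ ≤ ε := by
  simp only [weightedAverage]
  rw [← integral_sub (integrable_weightedAverage hk hg hC x)
    (integrable_weightedAverage hk hg hC (x + s))]
  simp only [← mul_sub]
  refine norm_integral_weight_mul_le hk hk0 hk1 fun t => ?_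
  rw [add_sub_right_comm]
  exact hs (x - t)

lemma integral_weightedAverage_mul_expChar (hk : Integrable k) (hg : Continuous g)
    (hC : ∀ x, ‖g x‖ ≤ C) (lam a b : ℝ) :
    ∫ x in a..b, weightedAverage k g x * expChar lam x
      = ∫ t, (k t : ℂ) * ∫ x in a..b, g (x - t) * expChar lam x := by
  have h : Integrable (Function.uncurry fun x t => (k t : ℂ) * g (x - t) * expChar lam x)
      ((volume.restrict (uIoc a b)).prod volume) := by
    have h1 : Integrable (fun z : ℝ × ℝ => (1 : ℂ) * (k z.2 : ℂ))
        ((volume.restrict (uIoc a b)).prod volume) := by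
      refine Integrable.mul_prod (f := fun _ : ℝ => (1 : ℂ)) (g := fun t => (k t : ℂ)) ?_ hk.ofReal
      exact intervalIntegrable_iff.1 (continuous_const.intervalIntegrable a b)
    have h2 := h1.mul_bdd (c := C) (g := fun z : ℝ × ℝ => g (z.1 - z.2) * expChar lam z.1)
      (Continuous.aestronglyMeasurable (by fun_prop))
      (Eventually.of_forall fun z => by rw [norm_mul, norm_expChar, mul_one]; exact hC _)
    refine h2.congr (Eventually.of_forall fun z => ?_)
    simp only [Function.uncurry, one_mul, mul_assoc]
  simp only [weightedAverage, ← integral_mul_const]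
  rw [intervalIntegral_integral_swap h]
  refine integral_congr_ae (Eventually.of_forall fun t => ?_)
  simp only [mul_assoc, intervalIntegral.integral_const_mul]

lemma norm_integral_translate_sub_le (hg : Continuous g) (hC : ∀ x, ‖g x‖ ≤ C)
    (lam T t : ℝ) :
    ‖(∫ x in (-T)..T, g (x - t) * expChar lam x)
      - expChar lam t * ∫ x in (-T)..T, g x * expChar lam x‖ ≤ 2 * C * |t| := by
  have hcont : Continuous fun x => g x * expChar lam x := by fun_prop
  have h1 := integral_shift_mul_expChar (fun x => g (x - t)) lam (-T - t) (T - t) t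
  simp only [sub_add_cancel, add_sub_cancel_right] at h1
  rw [h1, ← mul_sub, norm_mul, norm_expChar, one_mul,
    intervalIntegral.integral_interval_sub_interval_comm (hcont.intervalIntegrable _ _)
      (hcont.intervalIntegrable _ _) (hcont.intervalIntegrable _ _)]
  have h2 := norm_integral_mul_expChar_le hC lam (-T - t) (-T)
  have h3 := norm_integral_mul_expChar_le hC lam (T - t) T
  rw [sub_sub_cancel] at h2 h3
  linarith [norm_sub_le (∫ x in (-T - t)..(-T), g x * expChar lam x)
    (∫ x in (T - t)..T, g x * expChar lam x)]

lemma HasMeanR.translate (hg : Continuous g) (hC : ∀ x, ‖g x‖ ≤ C) {lam : ℝ} {c : ℂ}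
    (hm : HasMeanR g lam c) (t : ℝ) : HasMeanR (fun x => g (x - t)) lam (expChar lam t * c) := by
  have h1 : Tendsto (fun T : ℝ => 2 * C * |t| / (2 * T)) atTop (𝓝 0) :=
    tendsto_const_nhds.div_atTop (tendsto_id.const_mul_atTop two_pos)
  have h2 : Tendsto (fun T : ℝ => (1 / (2 * (T : ℂ))) *
      ((∫ x in (-T)..T, g (x - t) * expChar lam x)
        - expChar lam t * ∫ x in (-T)..T, g x * expChar lam x)) atTop (𝓝 0) := by
    refine squeeze_zero_norm' ?_ h1
    filter_upwards [eventually_gt_atTop 0] with T hT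
    rw [norm_mul, norm_div, norm_mul, Complex.norm_real, Real.norm_of_nonneg hT.le, norm_one,
      Complex.norm_ofNat, one_div, div_eq_inv_mul]
    gcongr
    exact norm_integral_translate_sub_le hg hC lam T t
  have h3 := h2.add (Tendsto.const_mul (expChar lam t) hm)
  rw [zero_add] at h3
  refine h3.congr fun T => ?_
  simp only [expChar]
  ring

lemma HasMeanR.weightedAverage (hk : Integrable k) (hg : Continuous g) (hC : ∀ x, ‖g x‖ ≤ C)
    {lam : ℝ} {c : ℂ} (hm : HasMeanR g lam c) :
    HasMeanR (weightedAverage k g) lam ((∫ t, (k t : ℂ) * expChar lam t) * c) := by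
  rw [← integral_mul_const]
  have key : Tendsto (fun T : ℝ => ∫ t, (k t : ℂ) *
      ((1 / (2 * (T : ℂ))) * ∫ x in (-T)..T, g (x - t) * expChar lam x)) atTop
      (𝓝 (∫ t, (k t : ℂ) * expChar lam t * c)) := by
    refine tendsto_integral_filter_of_dominated_convergence (fun t => ‖k t‖ * C) ?_ ?_
      (hk.norm.mul_const C) ?_
    · refine Eventually.of_forall fun T => hk.ofReal.aestronglyMeasurable.mul
        (Continuous.aestronglyMeasurable (continuous_const.mul ?_))
      exact intervalIntegral.continuous_parametric_intervalIntegral_of_continuous' (by fun_prop) _ _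
    · filter_upwards [eventually_gt_atTop 0] with T hT
      refine Eventually.of_forall fun t => ?_
      rw [norm_mul, Complex.norm_real]
      refine mul_le_mul_of_nonneg_left ?_ (norm_nonneg _)
      rw [norm_mul, norm_div, norm_mul, Complex.norm_real, Real.norm_of_nonneg hT.le, norm_one,
        Complex.norm_ofNat, one_div, inv_mul_le_iff₀ (by positivity)]
      refine (norm_integral_mul_expChar_le (fun x => hC (x - t)) lam (-T) T).trans (le_of_eq ?_)
      rw [abs_of_pos (by linarith)]
      ring
    · refine Eventually.of_forall fun t => ?_
      rw [mul_assoc]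
      exact Tendsto.const_mul _ (hm.translate hg hC t)
  refine key.congr fun T => ?_
  have h := integral_weightedAverage_mul_expChar hk hg hC lam (-T) T
  simp only [expChar] at h ⊢
  rw [h, ← integral_const_mul]
  congr 1 with t
  ring

end WeightedAverage

lemma HasMeanR.sub {g h : ℝ → ℂ} (hg : Continuous g) (hh : Continuous h) {lam : ℝ} {c d : ℂ}
    (hc : HasMeanR g lam c) (hd : HasMeanR h lam d) :
    HasMeanR (fun x => g x - h x) lam (c - d) := by
  refine (Tendsto.sub hc hd).congr fun T => ?_
  rw [← mul_sub, ← intervalIntegral.integral_sub]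
  · simp only [sub_mul]
  · exact Continuous.intervalIntegrable (by fun_prop) _ _
  · exact Continuous.intervalIntegrable (by fun_prop) _ _

lemma hasMeanR_const (c : ℂ) : HasMeanR (fun _ => c) 0 c := by
  refine tendsto_const_nhds.congr' ?_
  filter_upwards [eventually_gt_atTop 0] with T hT
  have hT' : (T : ℂ) ≠ 0 := by exact_mod_cast hT.ne'
  simp only [Complex.ofReal_zero, mul_zero, zero_mul, neg_zero, Complex.exp_zero, mul_one,
    intervalIntegral.integral_const, Complex.real_smul]
  push_cast
  field_simp
  ring

lemma HasMeanR.norm_le {g : ℝ → ℂ} {C : ℝ} (hC : ∀ x, ‖g x‖ ≤ C) {lam : ℝ} {c : ℂ}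
    (hm : HasMeanR g lam c) : ‖c‖ ≤ C := by
  refine le_of_tendsto hm.norm ?_
  filter_upwards [eventually_gt_atTop 0] with T hT
  rw [norm_mul, norm_div, norm_mul, Complex.norm_real, Real.norm_of_nonneg hT.le, norm_one,
    Complex.norm_ofNat, one_div, inv_mul_le_iff₀ (by positivity)]
  refine (norm_integral_mul_expChar_le hC lam (-T) T).trans (le_of_eq ?_)
  rw [abs_of_pos (by linarith)]
  ring

lemma HasMeanAt.hasMeanR {f : ℂ → ℂ} {y lam : ℝ} {c : ℂ} (h : HasMeanAt f y lam c) :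
    HasMeanR (fun x => f ((x : ℂ) + (y : ℂ) * Complex.I)) lam
      (cexp ((-(2 * Real.pi * lam * y) : ℝ) : ℂ) * c) := by
  refine (Tendsto.const_mul (cexp ((-(2 * Real.pi * lam * y) : ℝ) : ℂ)) h).congr fun T => ?_
  rw [mul_left_comm, ← intervalIntegral.integral_const_mul]
  congr 2 with x
  rw [mul_left_comm, ← Complex.exp_add]
  congr 2
  push_cast
  linear_combination (-2 * (Real.pi : ℂ) * lam * y) * Complex.I_sq

lemma RelDense.mono {σ τ : Set ℝ} (h : RelDense σ) (hst : σ ⊆ τ) : RelDense τ := by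
  obtain ⟨l, hl, h⟩ := h
  refine ⟨l, hl, fun x => ?_⟩
  obtain ⟨t, ht, hx⟩ := h x
  exact ⟨t, hst ht, hx⟩

section UpperHalfPlane

variable {f : ℂ → ℂ}

lemma APH.continuous_line (hf : APH f) {y : ℝ} (hy : 0 < y) :
    Continuous fun x : ℝ => f ((x : ℂ) + (y : ℂ) * Complex.I) :=
  hf.1.continuousOn.comp_continuous (by fun_prop) fun x => by
    show 0 < ((x : ℂ) + (y : ℂ) * Complex.I).im
    simpa using hy

lemma APH.relDense_common_almostPeriods (hf : APH f) {y₁ y₂ ε : ℝ} (hy₁ : 0 < y₁) (hy₂ : 0 < y₂)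
    (hε : 0 < ε) :
    RelDense {t : ℝ | ∀ x : ℝ,
      ‖f ((x : ℂ) + (y₁ : ℂ) * Complex.I) - f (((x + t : ℝ) : ℂ) + (y₁ : ℂ) * Complex.I)‖ ≤ ε ∧
      ‖f ((x : ℂ) + (y₂ : ℂ) * Complex.I) - f (((x + t : ℝ) : ℂ) + (y₂ : ℂ) * Complex.I)‖ ≤ ε} := by
  obtain ⟨τ, hτ, h⟩ := hf.2 (min y₁ y₂ / 2) (max y₁ y₂ + 1) ε (by positivity)
    (by linarith [min_le_max (a := y₁) (b := y₂), lt_min hy₁ hy₂]) hε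
  have key : ∀ t ∈ τ, ∀ x y : ℝ, min y₁ y₂ ≤ y → y ≤ max y₁ y₂ →
      ‖f ((x : ℂ) + (y : ℂ) * Complex.I) - f (((x + t : ℝ) : ℂ) + (y : ℂ) * Complex.I)‖ ≤ ε := by
    intro t ht x y h1 h2
    have h3 := h t ht ((x : ℂ) + (y : ℂ) * Complex.I)
      (by simpa using (half_lt_self (lt_min hy₁ hy₂)).trans_le h1)
      (by simpa using h2.trans_lt (lt_add_one _))
    rwa [add_right_comm, ← Complex.ofReal_add] at h3
  exact hτ.mono fun t ht x =>
    ⟨key t ht x y₁ (min_le_left _ _) (le_max_left _ _),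
      key t ht x y₂ (min_le_right _ _) (le_max_right _ _)⟩

lemma APH.apr_line (hf : APH f) {y : ℝ} (hy : 0 < y) :
    APR fun x : ℝ => f ((x : ℂ) + (y : ℂ) * Complex.I) :=
  ⟨hf.continuous_line hy, fun _ hε =>
    (hf.relDense_common_almostPeriods hy hy hε).mono fun _ ht x => (ht x).1⟩

lemma APH.eq_weightedAverage_halfPlanePoisson (hf : APH f) {m : ℝ → ℂ}
    (hm : ∀ lam : ℝ, ∀ y > (0 : ℝ), HasMeanAt f y lam (m lam))
    (hspec : ∀ lam, m lam ≠ 0 → 0 ≤ lam) {c y : ℝ} (hc : 0 < c) (hy : 0 < y) (x : ℝ) :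
    f ((x : ℂ) + ((c + y : ℝ) : ℂ) * Complex.I)
      = weightedAverage (halfPlanePoisson y) (fun x => f ((x : ℂ) + (c : ℂ) * Complex.I)) x := by
  have hcy : 0 < c + y := by positivity
  obtain ⟨C, -, hC⟩ := (hf.apr_line hc).bounded
  have hk := integrable_halfPlanePoisson hy
  have hcont := hf.continuous_line hc
  have hcont' := continuous_weightedAverage hk hcont hC
  have hd : APR fun x : ℝ => f ((x : ℂ) + ((c + y : ℝ) : ℂ) * Complex.I)
      - weightedAverage (halfPlanePoisson y) (fun x => f ((x : ℂ) + (c : ℂ) * Complex.I)) x := by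
    refine ⟨(hf.continuous_line hcy).sub hcont', fun ε hε => ?_⟩
    refine (hf.relDense_common_almostPeriods hcy hc (half_pos hε)).mono fun t ht x => ?_
    have h1 := (ht x).1
    have h2 := norm_weightedAverage_sub_shift_le hk (halfPlanePoisson_nonneg hy)
      (integral_halfPlanePoisson hy) hcont hC (fun x => (ht x).2) x
    rw [sub_sub_sub_comm]
    linarith [norm_sub_le_of_le h1 h2]
  refine sub_eq_zero.1 (hd.eq_zero_of_hasMeanR_zero (fun lam => ?_) x)
  have h1 := (hm lam (c + y) hcy).hasMeanR
  have h2 := (hm lam c hc).hasMeanR.weightedAverage hk hcont hC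
  have h3 := h1.sub (hf.continuous_line hcy) hcont' h2
  rw [integral_halfPlanePoisson_mul_expChar hy, ← mul_assoc, ← Complex.exp_add] at h3
  by_cases hlam : m lam = 0
  · simpa [hlam] using h3
  · rw [abs_of_nonneg (hspec lam hlam)] at h3
    convert h3 using 1
    rw [eq_comm, sub_eq_zero]
    congr 2
    push_cast
    ring

lemma APH.bounded_of_spectrum_nonneg (hf : APH f) {m : ℝ → ℂ}
    (hm : ∀ lam : ℝ, ∀ y > (0 : ℝ), HasMeanAt f y lam (m lam))
    (hspec : ∀ lam, m lam ≠ 0 → 0 ≤ lam) {c : ℝ} (hc : 0 < c) :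
    ∃ C : ℝ, ∀ z : ℂ, c < z.im → ‖f z‖ ≤ C := by
  obtain ⟨C, -, hC⟩ := (hf.apr_line hc).bounded
  refine ⟨C, fun z hz => ?_⟩
  have hy : 0 < z.im - c := sub_pos.2 hz
  have h := hf.eq_weightedAverage_halfPlanePoisson hm hspec hc hy z.re
  rw [add_sub_cancel, Complex.re_add_im] at h
  rw [h]
  exact norm_integral_weight_mul_le (integrable_halfPlanePoisson hy) (halfPlanePoisson_nonneg hy)
    (integral_halfPlanePoisson hy) fun t => hC _

lemma spectrum_nonneg_of_bounded {m : ℝ → ℂ}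
    (hm : ∀ lam : ℝ, ∀ y > (0 : ℝ), HasMeanAt f y lam (m lam)) {c C : ℝ} (hc : 0 < c)
    (hC : ∀ z : ℂ, c < z.im → ‖f z‖ ≤ C) (lam : ℝ) (hlam : m lam ≠ 0) : 0 ≤ lam := by
  by_contra! hneg
  have h1 : Tendsto (fun y : ℝ => Real.exp (2 * Real.pi * -lam * y) * ‖m lam‖) atTop atTop :=
    (Real.tendsto_exp_atTop.comp (tendsto_id.const_mul_atTop
      (mul_pos Real.two_pi_pos (neg_pos.2 hneg)))).atTop_mul_const (norm_pos_iff.2 hlam)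
  obtain ⟨y, hy, hyc⟩ := ((h1.eventually_gt_atTop C).and (eventually_gt_atTop c)).exists
  have h2 := (hm lam y (hc.trans hyc)).hasMeanR.norm_le (C := C)
    fun x => hC _ (by simpa using hyc)
  rw [norm_mul, Complex.norm_exp_ofReal] at h2
  rw [show -(2 * Real.pi * lam * y) = 2 * Real.pi * -lam * y by ring] at h2
  exact absurd hy (not_lt.2 h2)

lemma norm_sub_le_of_bounded_halfPlane (hf : DifferentiableOn ℂ f UHP) {c C Y : ℝ} (hc : 0 ≤ c)
    (hC : ∀ z : ℂ, c < z.im → ‖f z‖ ≤ C) {r : ℝ} (hr : 0 < r) (hY : c + r < Y) {z w : ℂ}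
    (hz : Y ≤ z.im) (hw : Y ≤ w.im) : ‖f z - f w‖ ≤ C / r * ‖z - w‖ := by
  have him : ∀ u : ℂ, Y ≤ u.im → ∀ v ∈ Metric.closedBall u r, c < v.im := by
    intro u hu v hv
    have h1 := (Complex.abs_im_le_norm (v - u)).trans (mem_closedBall_iff_norm.1 hv)
    rw [Complex.sub_im] at h1
    linarith [(abs_le.1 h1).1]
  have hopen : IsOpen UHP := isOpen_lt continuous_const Complex.continuous_im
  refine Convex.norm_image_sub_le_of_norm_deriv_le (s := {u : ℂ | Y ≤ u.im})
    (fun u hu => ?_) (fun u hu => ?_) (convex_halfSpace_im_ge Y) hw hz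
  · exact hf.differentiableAt (hopen.mem_nhds
      (hc.trans_lt (him u hu u (Metric.mem_closedBall_self hr.le))))
  · refine norm_deriv_le_of_forall_mem_sphere_norm_le hr
      (hf.diffContOnCl_ball fun v hv => hc.trans_lt (him u hu v hv)) fun v hv => ?_
    exact hC v (him u hu v (Metric.sphere_subset_closedBall hv))

lemma APH.uniform_tendsto_mean (hf : APH f) {m : ℝ → ℂ}
    (hm : ∀ lam : ℝ, ∀ y > (0 : ℝ), HasMeanAt f y lam (m lam))
    (hspec : ∀ lam, m lam ≠ 0 → 0 ≤ lam) {ε : ℝ} (hε : 0 < ε) :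
    ∃ Y : ℝ, ∀ y ≥ Y, ∀ x : ℝ, ‖f ((x : ℂ) + (y : ℂ) * Complex.I) - m 0‖ ≤ ε := by
  obtain ⟨C, hC⟩ := hf.bounded_of_spectrum_nonneg hm hspec one_pos
  have hcont := hf.continuous_line one_pos
  obtain ⟨C₁, -, hC₁⟩ := (hf.apr_line one_pos).bounded
  set g : ℝ → ℂ := fun x => f ((x : ℂ) + ((1 : ℝ) : ℂ) * Complex.I) - m 0 with hg
  have hg_cont : Continuous g := hcont.sub continuous_const
  have hg_apr : APR g := ⟨hg_cont, fun ε hε =>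
    ((hf.apr_line one_pos).2 ε hε).mono fun t ht x => by simpa [hg] using ht x⟩
  have hg_mean : HasMeanR g 0 0 := by
    simpa [hg] using (hm 0 1 one_pos).hasMeanR.sub hcont continuous_const (hasMeanR_const (m 0))
  obtain ⟨C₂, -, hC₂⟩ := hg_apr.bounded
  obtain ⟨T, hT, hmean⟩ := hg_apr.exists_uniform_mean hg_mean (half_pos hε)
  have hC0 : 0 ≤ C := (norm_nonneg _).trans (hC (2 * Complex.I) (by simp))
  set r : ℝ := 2 * C * T / ε + 1 with hr
  have hr0 : 0 < r := by positivity
  refine ⟨r + 2, fun y hy x => ?_⟩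
  have hy0 : 0 < y - 1 := by linarith
  have hk := integrable_halfPlanePoisson hy0
  set h : ℝ → ℂ := fun s => f ((s : ℂ) + (y : ℂ) * Complex.I) - m 0 with hh
  have hh_cont : Continuous h := (hf.continuous_line (by linarith)).sub continuous_const
  have hh_eq : ∀ s, h s = weightedAverage (halfPlanePoisson (y - 1)) g s := by
    intro s
    have h1 := hf.eq_weightedAverage_halfPlanePoisson hm hspec one_pos hy0 s
    rw [add_sub_cancel] at h1
    rw [hg, weightedAverage_sub hk hcont hC₁ continuous_const (fun _ => le_rfl),
      weightedAverage_const (integral_halfPlanePoisson hy0), ← h1]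
  have hh_mean : ‖∫ s in x..(x + T), h s‖ ≤ ε / 2 * T := by
    have h1 := integral_weightedAverage_mul_expChar hk hg_cont hC₂ 0 x (x + T)
    have h2 : ∀ s, expChar 0 s = 1 := by simp [expChar]
    simp only [h2, mul_one, ← hh_eq] at h1 hmean
    rw [h1]
    refine norm_integral_weight_mul_le hk (halfPlanePoisson_nonneg hy0)
      (integral_halfPlanePoisson hy0) fun t => ?_
    rw [intervalIntegral.integral_comp_sub_right, add_sub_right_comm]
    exact hmean (x - t)
  have hslow : ‖∫ s in x..(x + T), (h x - h s)‖ ≤ ε / 2 * |x + T - x| := by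
    refine intervalIntegral.norm_integral_le_of_norm_le_const fun s hs => ?_
    rw [uIoc_of_le (by linarith), mem_Ioc] at hs
    have h1 := norm_sub_le_of_bounded_halfPlane hf.1 zero_le_one hC hr0
      (show 1 + r < y by linarith) (z := (x : ℂ) + (y : ℂ) * Complex.I)
      (w := (s : ℂ) + (y : ℂ) * Complex.I) (by simp) (by simp)
    simp only [hh, sub_sub_sub_cancel_right]
    refine h1.trans ?_
    rw [add_sub_add_right_eq_sub, ← Complex.ofReal_sub, Complex.norm_real, Real.norm_eq_abs,
      abs_of_nonpos (by linarith)]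
    calc C / r * -(x - s) ≤ C / r * T := by gcongr; linarith
      _ ≤ ε / 2 := by
        rw [div_mul_eq_mul_div, div_le_iff₀ hr0, hr]
        have : ε / 2 * (2 * C * T / ε + 1) = C * T + ε / 2 := by field_simp
        linarith
  rw [intervalIntegral.integral_sub (continuous_const.intervalIntegrable _ _)
    (hh_cont.intervalIntegrable _ _), intervalIntegral.integral_const, add_sub_cancel_left,
    abs_of_pos hT] at hslow
  have h3 := norm_le_norm_add_norm_sub' (T • h x) (∫ s in x..(x + T), h s)
  rw [norm_smul, Real.norm_of_nonneg hT.le] at h3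
  have h4 : T * ‖h x‖ ≤ T * ε := by linarith
  exact le_of_mul_le_mul_left h4 hT

end UpperHalfPlane

/-- Lemma 5.2(i): `f ∈ AP(ℍ)` is bounded on some upper half-plane iff its spectrum is
contained in `[0,∞)`; in that case it is bounded on every upper half-plane and
`f(x+iy) → ℰf(0)` uniformly as `y → ∞`. -/
theorem stmt15 (f : ℂ → ℂ) (hf : APH f)
    (m : ℝ → ℂ) (hm : ∀ (lam : ℝ), ∀ y > (0:ℝ), HasMeanAt f y lam (m lam)) :
    ((∃ c > (0:ℝ), ∃ C : ℝ, ∀ z : ℂ, c < z.im → ‖f z‖ ≤ C) ↔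
      ∀ lam : ℝ, m lam ≠ 0 → 0 ≤ lam) ∧
    ((∃ c > (0:ℝ), ∃ C : ℝ, ∀ z : ℂ, c < z.im → ‖f z‖ ≤ C) →
      (∀ c > (0:ℝ), ∃ C : ℝ, ∀ z : ℂ, c < z.im → ‖f z‖ ≤ C) ∧
      ∀ ε > (0:ℝ), ∃ Y : ℝ, ∀ y ≥ Y, ∀ x : ℝ,
        ‖f ((x : ℂ) + (y : ℂ) * Complex.I) - m 0‖ ≤ ε) := by
  have hspec : (∃ c > (0:ℝ), ∃ C : ℝ, ∀ z : ℂ, c < z.im → ‖f z‖ ≤ C) →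
      ∀ lam : ℝ, m lam ≠ 0 → 0 ≤ lam := by
    rintro ⟨c, hc, C, hC⟩
    exact spectrum_nonneg_of_bounded hm hc hC
  refine ⟨⟨hspec, fun h => ⟨1, one_pos, hf.bounded_of_spectrum_nonneg hm h one_pos⟩⟩,
    fun h => ⟨fun c hc => hf.bounded_of_spectrum_nonneg hm (hspec h) hc,
      fun ε hε => hf.uniform_tendsto_mean hm (hspec h) hε⟩⟩
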